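/- Let n > 1 be a positive integer with n ≡ 1 (mod 6). Then ∑_{k=0}^{n−1} (q^{−1};q^6)_k (q^{−1};q^6)_k (q^{−4};q^6)_k · q^{6k} / (q^6;q^6)_k^3 ≡ 0 (mod Φ_n(q)^2), as rational functions of q over ℚ. -/

import Mathlib

open Finset Polynomial

/-- The q-shifted factorial `(x; q)_k = ∏_{j=0}^{k-1} (1 - x q^j)` in `RatFunc ℚ`. -/
noncomputable def qPoch (x q : RatFunc ℚ) (k : ℕ) : RatFunc ℚ :=
  ∏ j ∈ Finset.range k, (1 - x * q ^ j)

/-- `A ≡ 0 (mod P)`: `A = P · B` for some rational function `B` whose denominator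
(in lowest terms) is coprime to `P`. -/
def CongrZero (A : RatFunc ℚ) (P : Polynomial ℚ) : Prop :=
  ∃ B : RatFunc ℚ, A = algebraMap (Polynomial ℚ) (RatFunc ℚ) P * B ∧ IsCoprime B.denom P

section QSeries

theorem qPoch_zero (x q : RatFunc ℚ) : qPoch x q 0 = 1 := by simp [qPoch]

theorem qPoch_succ (x q : RatFunc ℚ) (k : ℕ) :
    qPoch x q (k + 1) = qPoch x q k * (1 - x * q ^ k) := by
  simp [qPoch, Finset.prod_range_succ]

theorem qPoch_succ_left (x q : RatFunc ℚ) (k : ℕ) :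
    qPoch x q (k + 1) = (1 - x) * qPoch (x * q) q k := by
  simp only [qPoch, Finset.prod_range_succ', pow_zero, mul_one]
  rw [mul_comm]
  congr 1
  exact Finset.prod_congr rfl fun j _ => by ring

theorem qPoch_add (x q : RatFunc ℚ) (k l : ℕ) :
    qPoch x q (k + l) = qPoch x q k * qPoch (x * q ^ k) q l := by
  simp only [qPoch, Finset.prod_range_add]
  congr 1
  exact Finset.prod_congr rfl fun j _ => by ring

theorem qPoch_eq_zero {x q : RatFunc ℚ} {j k : ℕ} (hj : j < k) (h : x * q ^ j = 1) :
    qPoch x q k = 0 :=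
  Finset.prod_eq_zero (Finset.mem_range.2 hj) (by rw [h, sub_self])

theorem qPoch_self_ne_zero {q : RatFunc ℚ} (hq : ∀ j, q ^ (j + 1) ≠ 1) (k : ℕ) :
    qPoch q q k ≠ 0 :=
  Finset.prod_ne_zero_iff.2 fun j _ h => hq j (by rw [pow_succ']; exact (sub_eq_zero.1 h).symm)

theorem sum_qPoch_div_mul_pow_contiguous {q : RatFunc ℚ} (hq : ∀ j, q ^ (j + 1) ≠ 1)
    (b z : RatFunc ℚ) (K : ℕ) :
    ∑ k ∈ Finset.range (K + 1), qPoch b q k / qPoch q q k * z ^ k =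
      ∑ k ∈ Finset.range (K + 1), qPoch (b * q) q k / qPoch q q k * z ^ k -
        b * z * ∑ k ∈ Finset.range K, qPoch (b * q) q k / qPoch q q k * z ^ k := by
  induction K with
  | zero => simp [qPoch_zero]
  | succ K ih =>
    rw [Finset.sum_range_succ, ih, Finset.sum_range_succ _ (K + 1),
      Finset.sum_range_succ (fun k => qPoch (b * q) q k / qPoch q q k * z ^ k) K,
      qPoch_succ_left b, qPoch_succ (b * q), qPoch_succ q]
    have h1 := qPoch_self_ne_zero hq K
    have h2 : 1 - q * q ^ K ≠ 0 := fun h => hq K (by rw [pow_succ']; exact (sub_eq_zero.1 h).symm)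
    field_simp
    ring

/-- The terminating `q`-binomial sum vanishes at `z = q ^ (j + 1)` for `j < N`. -/
theorem sum_qPoch_div_mul_pow_eq_zero {q : RatFunc ℚ} (hq0 : q ≠ 0)
    (hq : ∀ j, q ^ (j + 1) ≠ 1) {N j K : ℕ} (hj : j < N) (hK : N < K) :
    ∑ k ∈ Finset.range K, qPoch (q ^ N)⁻¹ q k / qPoch q q k * (q ^ (j + 1)) ^ k = 0 := by
  induction N generalizing K with
  | zero => omega
  | succ N ih =>
    obtain ⟨K, rfl⟩ : ∃ K', K = K' + 1 := ⟨K - 1, by omega⟩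
    have hb : (q ^ (N + 1))⁻¹ * q = (q ^ N)⁻¹ := by
      rw [pow_succ]; field_simp
    rw [sum_qPoch_div_mul_pow_contiguous hq, hb, Finset.sum_range_succ,
      qPoch_eq_zero (show N < K by omega) (inv_mul_cancel₀ (pow_ne_zero N hq0))]
    rcases Nat.lt_succ_iff_lt_or_eq.1 hj with h | rfl
    · rw [ih h (by omega)]; simp
    · rw [inv_mul_cancel₀ (pow_ne_zero _ hq0)]; ring

theorem sum_qPoch_div_mul_eval_eq_zero {q : RatFunc ℚ} (hq0 : q ≠ 0)
    (hq : ∀ j, q ^ (j + 1) ≠ 1) {N K : ℕ} (hK : N < K) (p : (RatFunc ℚ)[X])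
    (hp : p.natDegree < N) :
    ∑ k ∈ Finset.range K, qPoch (q ^ N)⁻¹ q k / qPoch q q k * q ^ k * p.eval (q ^ k) = 0 := by
  simp only [Polynomial.eval_eq_sum_range, Finset.mul_sum]
  rw [Finset.sum_comm]
  refine Finset.sum_eq_zero fun j hj => ?_
  have := sum_qPoch_div_mul_pow_eq_zero hq0 hq (j := j) (N := N) (K := K)
    (by have := Finset.mem_range.1 hj; omega) hK
  rw [← mul_zero (p.coeff j), ← this, Finset.mul_sum]
  refine Finset.sum_congr rfl fun k _ => ?_
  ring

/-- `(q ^ (r + 1); q)_k / (q; q)_k` is a polynomial of degree at most `r` in `q ^ k`. -/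
theorem exists_polynomial_qPoch_div {q : RatFunc ℚ} (hq : ∀ j, q ^ (j + 1) ≠ 1) (r : ℕ) :
    ∃ p : (RatFunc ℚ)[X], p.natDegree ≤ r ∧
      ∀ k, qPoch (q ^ (r + 1)) q k / qPoch q q k = p.eval (q ^ k) := by
  refine ⟨Polynomial.C (qPoch q q r)⁻¹ *
    ∏ i ∈ Finset.range r, (1 - Polynomial.C (q ^ (i + 1)) * Polynomial.X), ?_, fun k => ?_⟩
  · refine (Polynomial.natDegree_C_mul_le _ _).trans ((Polynomial.natDegree_prod_le _ _).trans ?_)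
    refine (Finset.sum_le_card_nsmul _ _ 1 fun i _ => ?_).trans (by simp)
    refine (Polynomial.natDegree_sub_le _ _).trans ?_
    simpa using Polynomial.natDegree_C_mul_X_pow_le (q ^ (i + 1)) 1
  · have h := (qPoch_add q q r k).symm.trans ((add_comm r k) ▸ qPoch_add q q k r)
    have h' : (∏ i ∈ Finset.range r, (1 - Polynomial.C (q ^ (i + 1)) * Polynomial.X)).eval (q ^ k)
        = qPoch (q * q ^ k) q r := by
      simp only [Polynomial.eval_prod, qPoch]
      refine Finset.prod_congr rfl fun i _ => ?_
      simp; ring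
    rw [Polynomial.eval_mul, h', Polynomial.eval_C]
    have h1 := qPoch_self_ne_zero hq k
    have h2 := qPoch_self_ne_zero hq r
    rw [pow_succ']
    field_simp
    linear_combination h

/-- A `q`-analogue of a Karlsson–Minton type vanishing sum. -/
theorem sum_qPoch_karlsson_minton {q : RatFunc ℚ} (hq0 : q ≠ 0)
    (hq : ∀ j, q ^ (j + 1) ≠ 1) {N K r s : ℕ} (hK : N < K) (hrs : r + s < N) :
    ∑ k ∈ Finset.range K, qPoch (q ^ N)⁻¹ q k * qPoch (q ^ (r + 1)) q k *
      qPoch (q ^ (s + 1)) q k * q ^ k / (qPoch q q k) ^ 3 = 0 := by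
  obtain ⟨p, hp, hpe⟩ := exists_polynomial_qPoch_div hq r
  obtain ⟨p', hp', hpe'⟩ := exists_polynomial_qPoch_div hq s
  rw [← sum_qPoch_div_mul_eval_eq_zero hq0 hq hK (p * p')
    (Polynomial.natDegree_mul_le.trans_lt (by omega))]
  refine Finset.sum_congr rfl fun k _ => ?_
  rw [Polynomial.eval_mul, ← hpe, ← hpe']
  have h1 := qPoch_self_ne_zero hq k
  field_simp

end QSeries

section FirstOrder

theorem exists_zpow_expansion {O : Subring (RatFunc ℚ)} {u : RatFunc ℚ} (hu0 : u ≠ 0)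
    (hu : u ∈ O) (hu' : u⁻¹ ∈ O) (i : ℤ) :
    ∃ c ∈ O, u ^ i = 1 + i * (u - 1) + (u - 1) ^ 2 * c := by
  induction i with
  | zero => exact ⟨0, O.zero_mem, by simp⟩
  | succ i ih =>
    obtain ⟨c, hc, h⟩ := ih
    refine ⟨i + c * u, O.add_mem (natCast_mem O i) (O.mul_mem hc hu), ?_⟩
    rw [zpow_add_one₀ hu0, h]; push_cast; ring
  | pred i ih =>
    obtain ⟨c, hc, h⟩ := ih
    refine ⟨(i + 1) * u⁻¹ + c * u⁻¹, O.add_mem (O.mul_mem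
      (O.add_mem (natCast_mem O i) O.one_mem) hu') (O.mul_mem hc hu'), ?_⟩
    rw [zpow_sub_one₀ hu0, h]; push_cast; field_simp; ring

theorem qPoch_mem {O : Subring (RatFunc ℚ)} {a q : RatFunc ℚ} (ha : a ∈ O) (hq : q ∈ O) (k : ℕ) :
    qPoch a q k ∈ O :=
  O.prod_mem fun j _ => O.sub_mem O.one_mem (O.mul_mem ha (O.pow_mem hq j))

theorem exists_qPoch_expansion {O : Subring (RatFunc ℚ)} {u a q : RatFunc ℚ} (hu0 : u ≠ 0)
    (hu : u ∈ O) (hu' : u⁻¹ ∈ O) (ha : a ∈ O) (hq : q ∈ O) (k : ℕ) :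
    ∃ D ∈ O, ∀ i : ℤ, ∃ c ∈ O,
      qPoch (a * u ^ i) q k = qPoch a q k + i * (u - 1) * D + (u - 1) ^ 2 * c := by
  induction k with
  | zero => exact ⟨0, O.zero_mem, fun i => ⟨0, O.zero_mem, by simp [qPoch_zero]⟩⟩
  | succ k ih =>
    obtain ⟨D, hD, h⟩ := ih
    have hg : a * q ^ k ∈ O := O.mul_mem ha (O.pow_mem hq k)
    have hf : 1 - a * q ^ k ∈ O := O.sub_mem O.one_mem hg
    have hP := qPoch_mem ha hq k
    refine ⟨D * (1 - a * q ^ k) - qPoch a q k * (a * q ^ k),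
      O.sub_mem (O.mul_mem hD hf) (O.mul_mem hP hg), fun i => ?_⟩
    obtain ⟨c, hc, hi⟩ := h i
    obtain ⟨d, hd, hui⟩ := exists_zpow_expansion hu0 hu hu' i
    have he : u - 1 ∈ O := O.sub_mem hu O.one_mem
    have hI : (i : RatFunc ℚ) ∈ O := intCast_mem O i
    refine ⟨c * (1 - a * q ^ k) - (i * (i * D) + c * ((u - 1) * i)) * (a * q ^ k)
      - qPoch (a * u ^ i) q k * (d * (a * q ^ k)), ?_, ?_⟩
    · rw [hi]
      have h2 := O.pow_mem he 2
      exact O.sub_mem (O.sub_mem (O.mul_mem hc hf) (O.mul_mem (O.add_mem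
        (O.mul_mem hI (O.mul_mem hI hD)) (O.mul_mem hc (O.mul_mem he hI))) hg))
        (O.mul_mem (O.add_mem (O.add_mem hP (O.mul_mem (O.mul_mem hI he) hD))
          (O.mul_mem h2 hc)) (O.mul_mem hd hg))
    · rw [qPoch_succ, qPoch_succ, hui, ← hui, hi, mul_assoc a, mul_comm (u ^ i), ← mul_assoc a, hui]
      ring

/-- Modulo `(u - 1) ^ 2` the first-order terms of the two deformed products cancel. -/
theorem exists_qPoch_combination {O : Subring (RatFunc ℚ)} {u a b q : RatFunc ℚ} (hu0 : u ≠ 0)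
    (hu : u ∈ O) (hu' : u⁻¹ ∈ O) (ha : a ∈ O) (hb : b ∈ O) (hq : q ∈ O) (k : ℕ) :
    ∃ c ∈ O, 3 * (qPoch a q k * qPoch a q k * qPoch b q k) =
      qPoch (a * u ^ (-5 : ℤ)) q k * qPoch (a * u ^ (1 : ℤ)) q k * qPoch (b * u ^ (4 : ℤ)) q k +
      2 * (qPoch (b * u ^ (-2 : ℤ)) q k * qPoch (a * u ^ (1 : ℤ)) q k *
        qPoch (a * u ^ (1 : ℤ)) q k) + (u - 1) ^ 2 * c := by
  obtain ⟨D, hD, h⟩ := exists_qPoch_expansion hu0 hu hu' ha hq k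
  obtain ⟨E, hE, h'⟩ := exists_qPoch_expansion hu0 hu hu' hb hq k
  obtain ⟨c₁, hc₁, h₁⟩ := h (-5)
  obtain ⟨c₂, hc₂, h₂⟩ := h 1
  obtain ⟨c₃, hc₃, h₃⟩ := h' 4
  obtain ⟨c₄, hc₄, h₄⟩ := h' (-2)
  have hA := qPoch_mem ha hq k
  have hB := qPoch_mem hb hq k
  rw [h₁, h₂, h₃, h₄]
  generalize qPoch a q k = A at *
  generalize qPoch b q k = B at *
  obtain ⟨e, he⟩ : ∃ e : O, (e : RatFunc ℚ) = u - 1 := ⟨⟨u - 1, O.sub_mem hu O.one_mem⟩, rfl⟩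
  rw [← he]
  lift A to O using hA
  lift B to O using hB
  lift D to O using hD
  lift E to O using hE
  lift c₁ to O using hc₁
  lift c₂ to O using hc₂
  lift c₃ to O using hc₃
  lift c₄ to O using hc₄
  have key : e ^ 2 ∣ 3 * (A * A * B) - ((A + (-5 : ℤ) * e * D + e ^ 2 * c₁) *
      (A + (1 : ℤ) * e * D + e ^ 2 * c₂) * (B + (4 : ℤ) * e * E + e ^ 2 * c₃) +
      2 * ((B + (-2 : ℤ) * e * E + e ^ 2 * c₄) * (A + (1 : ℤ) * e * D + e ^ 2 * c₂) *
        (A + (1 : ℤ) * e * D + e ^ 2 * c₂))) := by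
    rw [← Ideal.mem_span_singleton, ← Ideal.Quotient.eq_zero_iff_mem]
    have h0 : (Ideal.Quotient.mk (Ideal.span {e ^ 2})) e ^ 2 = 0 := by
      rw [← map_pow]; exact Ideal.Quotient.eq_zero_iff_mem.2 (Ideal.mem_span_singleton_self _)
    simp only [map_sub, map_add, map_mul, map_pow, map_intCast, map_ofNat, h0, zero_mul, add_zero]
    push_cast
    generalize (Ideal.Quotient.mk (Ideal.span {e ^ 2})) e = e' at *
    generalize (Ideal.Quotient.mk (Ideal.span {e ^ 2})) A = A
    generalize (Ideal.Quotient.mk (Ideal.span {e ^ 2})) B = B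
    generalize (Ideal.Quotient.mk (Ideal.span {e ^ 2})) D = D
    generalize (Ideal.Quotient.mk (Ideal.span {e ^ 2})) E = E
    grind
  obtain ⟨c, hc⟩ := key
  refine ⟨c, c.2, ?_⟩
  have := congrArg O.subtype hc
  simp only [map_sub, map_add, map_mul, map_pow, map_intCast, map_ofNat, Subring.subtype_apply]
    at this
  linear_combination this

end FirstOrder

section Coprime

/-- The rational functions whose reduced denominator is coprime to `P`. -/
noncomputable def coprimeDenom (P : ℚ[X]) : Subring (RatFunc ℚ) where
  carrier := {A | IsCoprime A.denom P}
  mul_mem' {a b} ha hb :=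
    (IsCoprime.mul_left ha hb).of_isCoprime_of_dvd_left (RatFunc.denom_mul_dvd a b)
  add_mem' {a b} ha hb :=
    (IsCoprime.mul_left ha hb).of_isCoprime_of_dvd_left (RatFunc.denom_add_dvd a b)
  one_mem' := by simp [isCoprime_one_left]
  zero_mem' := by simp [isCoprime_one_left]
  neg_mem' {a} ha := by
    have h := RatFunc.denom_mul_dvd (RatFunc.C (-1)) a
    rw [RatFunc.denom_C, one_mul, map_neg, map_one, neg_one_mul] at h
    exact IsCoprime.of_isCoprime_of_dvd_left ha h

theorem mem_coprimeDenom {P : ℚ[X]} {A : RatFunc ℚ} :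
    A ∈ coprimeDenom P ↔ IsCoprime A.denom P := Iff.rfl

theorem algebraMap_mem_coprimeDenom (P p : ℚ[X]) :
    algebraMap ℚ[X] (RatFunc ℚ) p ∈ coprimeDenom P := by
  simp [mem_coprimeDenom, isCoprime_one_left]

theorem inv_algebraMap_mem_coprimeDenom {P p : ℚ[X]} (h : IsCoprime p P) :
    (algebraMap ℚ[X] (RatFunc ℚ) p)⁻¹ ∈ coprimeDenom P := by
  have := RatFunc.denom_div_dvd (1 : ℚ[X]) p
  rw [map_one, one_div] at this
  exact h.of_isCoprime_of_dvd_left this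

theorem isCoprime_X_cyclotomic {n : ℕ} (hn : 0 < n) :
    IsCoprime (X : ℚ[X]) (cyclotomic n ℚ) := by
  have h : IsCoprime (X : ℚ[X]) (X ^ n - 1) :=
    ⟨X ^ (n - 1), -1, by rw [← pow_succ, Nat.sub_add_cancel hn]; ring⟩
  exact h.of_isCoprime_of_dvd_right (cyclotomic.dvd_X_pow_sub_one n ℚ)

theorem isCoprime_X_pow_sub_one_cyclotomic {n s : ℕ} (hs : 0 < s) (h : ¬ n ∣ s) :
    IsCoprime (X ^ s - 1 : ℚ[X]) (cyclotomic n ℚ) := by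
  rw [← prod_cyclotomic_eq_X_pow_sub_one hs]
  refine IsCoprime.prod_left fun d hd => cyclotomic.isCoprime_rat ?_
  rintro rfl
  exact h (Nat.dvd_of_mem_divisors hd)

theorem ratFuncX_pow_ne_one {s : ℕ} (hs : 0 < s) : (RatFunc.X : RatFunc ℚ) ^ s ≠ 1 := by
  intro h
  rw [← RatFunc.algebraMap_X, ← map_pow, ← map_one (algebraMap ℚ[X] (RatFunc ℚ))] at h
  have := congrArg natDegree (RatFunc.algebraMap_injective ℚ h)
  simp at this
  omega

theorem inv_qPoch_mem_coprimeDenom {n k : ℕ} (hn : n.Coprime 6) (hk : k < n) :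
    (qPoch ((RatFunc.X : RatFunc ℚ) ^ 6) (RatFunc.X ^ 6) k)⁻¹ ∈
      coprimeDenom (cyclotomic n ℚ ^ 2) := by
  rw [qPoch, ← Finset.prod_inv_distrib]
  refine Subring.prod_mem _ fun j hj => ?_
  have hj := Finset.mem_range.1 hj
  have h : ¬ n ∣ 6 * (j + 1) := fun h => by
    have := Nat.le_of_dvd (Nat.succ_pos j) (hn.dvd_of_dvd_mul_left h)
    omega
  have := inv_algebraMap_mem_coprimeDenom
    ((isCoprime_X_pow_sub_one_cyclotomic (by omega) h).neg_left.pow_right (n := 2))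
  rwa [show algebraMap ℚ[X] (RatFunc ℚ) (-(X ^ (6 * (j + 1)) - 1)) =
    1 - RatFunc.X ^ 6 * (RatFunc.X ^ 6) ^ j by
      simp only [map_neg, map_sub, map_pow, map_one, RatFunc.algebraMap_X]; ring] at this

end Coprime

theorem stmt7 (n : ℕ) (hn : 0 < n) (hn1 : 1 < n) (hmod : n % 6 = 1) :
    CongrZero
      (∑ k ∈ Finset.range n,
        qPoch ((RatFunc.X : RatFunc ℚ) ^ ((-1) : ℤ)) (RatFunc.X ^ 6) k
            * qPoch ((RatFunc.X : RatFunc ℚ) ^ ((-1) : ℤ)) (RatFunc.X ^ 6) k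
            * qPoch ((RatFunc.X : RatFunc ℚ) ^ ((-4) : ℤ)) (RatFunc.X ^ 6) k
            * RatFunc.X ^ (6 * k)
          / (qPoch ((RatFunc.X : RatFunc ℚ) ^ 6) (RatFunc.X ^ 6) k) ^ 3)
      ((Polynomial.cyclotomic n ℚ) ^ 2) := by
  obtain ⟨m, rfl⟩ : ∃ m, n = 6 * m + 1 := ⟨n / 6, by omega⟩
  set n := 6 * m + 1 with hn_def
  set O := coprimeDenom (cyclotomic n ℚ ^ 2)
  have hX0 : (RatFunc.X : RatFunc ℚ) ≠ 0 := RatFunc.X_ne_zero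
  have hX : (RatFunc.X : RatFunc ℚ) ∈ O := by
    simpa using algebraMap_mem_coprimeDenom (cyclotomic n ℚ ^ 2) X
  have hX' : (RatFunc.X : RatFunc ℚ)⁻¹ ∈ O := by
    simpa using inv_algebraMap_mem_coprimeDenom ((isCoprime_X_cyclotomic hn).pow_right (n := 2))
  have hQ0 : (RatFunc.X : RatFunc ℚ) ^ 6 ≠ 0 := pow_ne_zero 6 hX0
  have hQ : ∀ j, ((RatFunc.X : RatFunc ℚ) ^ 6) ^ (j + 1) ≠ 1 := fun j => by
    rw [← pow_mul]; exact ratFuncX_pow_ne_one (by omega)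
  have hcop : n.Coprime 6 := by
    rw [Nat.Coprime, Nat.gcd_comm, Nat.gcd_rec, hmod]
    simp
  have ha : (RatFunc.X : RatFunc ℚ) ^ (-1 : ℤ) ∈ O := by simpa using hX'
  have hb : (RatFunc.X : RatFunc ℚ) ^ (-4 : ℤ) ∈ O := by
    rw [show (-4 : ℤ) = -(4 : ℕ) by rfl, zpow_neg, zpow_natCast, ← inv_pow]
    exact O.pow_mem hX' 4
  choose c hc hcomb using exists_qPoch_combination (pow_ne_zero n hX0) (O.pow_mem hX n)
    (by rw [← inv_pow]; exact O.pow_mem hX' n) ha hb (O.pow_mem hX 6)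
  have e1 : (RatFunc.X : RatFunc ℚ) ^ (-1 : ℤ) * (RatFunc.X ^ n) ^ (-5 : ℤ) =
      ((RatFunc.X ^ 6) ^ (5 * m + 1))⁻¹ := by
    simp only [← zpow_natCast, ← zpow_mul, ← zpow_neg, ← zpow_add₀ hX0]
    congr 1; push_cast [hn_def]; ring
  have e2 : (RatFunc.X : RatFunc ℚ) ^ (-1 : ℤ) * (RatFunc.X ^ n) ^ (1 : ℤ) =
      (RatFunc.X ^ 6) ^ (m - 1 + 1) := by
    rw [show m - 1 + 1 = m by omega]
    simp only [← zpow_natCast, ← zpow_mul, ← zpow_add₀ hX0]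
    congr 1; push_cast [hn_def]; ring
  have e3 : (RatFunc.X : RatFunc ℚ) ^ (-4 : ℤ) * (RatFunc.X ^ n) ^ (4 : ℤ) =
      (RatFunc.X ^ 6) ^ (4 * m - 1 + 1) := by
    rw [show 4 * m - 1 + 1 = 4 * m by omega]
    simp only [← zpow_natCast, ← zpow_mul, ← zpow_add₀ hX0]
    congr 1; push_cast [hn_def]; ring
  have e4 : (RatFunc.X : RatFunc ℚ) ^ (-4 : ℤ) * (RatFunc.X ^ n) ^ (-2 : ℤ) =
      ((RatFunc.X ^ 6) ^ (2 * m + 1))⁻¹ := by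
    simp only [← zpow_natCast, ← zpow_mul, ← zpow_neg, ← zpow_add₀ hX0]
    congr 1; push_cast [hn_def]; ring
  rw [e1, e2, e3, e4] at hcomb
  have v1 := sum_qPoch_karlsson_minton hQ0 hQ (N := 5 * m + 1) (K := n) (r := m - 1)
    (s := 4 * m - 1) (by omega) (by omega)
  have v2 := sum_qPoch_karlsson_minton hQ0 hQ (N := 2 * m + 1) (K := n) (r := m - 1)
    (s := m - 1) (by omega) (by omega)
  obtain ⟨g, hg⟩ := cyclotomic.dvd_X_pow_sub_one n ℚ
  have hg' : (RatFunc.X : RatFunc ℚ) ^ n - 1 =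
      algebraMap ℚ[X] (RatFunc ℚ) (cyclotomic n ℚ) * algebraMap ℚ[X] (RatFunc ℚ) g := by
    rw [← map_mul, ← hg]; simp
  have h3 : (3 : RatFunc ℚ)⁻¹ ∈ O := by
    have := algebraMap_mem_coprimeDenom (cyclotomic n ℚ ^ 2) (C (3⁻¹ : ℚ))
    simpa [RatFunc.algebraMap_C] using this
  refine ⟨3⁻¹ * algebraMap ℚ[X] (RatFunc ℚ) g ^ 2 * ∑ k ∈ Finset.range n, c k *
    (RatFunc.X ^ 6) ^ k * ((qPoch (RatFunc.X ^ 6) (RatFunc.X ^ 6) k)⁻¹) ^ 3, ?_, ?_⟩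
  · have hsum : 3 * ∑ k ∈ Finset.range n,
        qPoch ((RatFunc.X : RatFunc ℚ) ^ ((-1) : ℤ)) (RatFunc.X ^ 6) k
            * qPoch ((RatFunc.X : RatFunc ℚ) ^ ((-1) : ℤ)) (RatFunc.X ^ 6) k
            * qPoch ((RatFunc.X : RatFunc ℚ) ^ ((-4) : ℤ)) (RatFunc.X ^ 6) k
            * RatFunc.X ^ (6 * k)
          / (qPoch ((RatFunc.X : RatFunc ℚ) ^ 6) (RatFunc.X ^ 6) k) ^ 3 =
        (RatFunc.X ^ n - 1) ^ 2 * ∑ k ∈ Finset.range n, c k *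
          (RatFunc.X ^ 6) ^ k * ((qPoch (RatFunc.X ^ 6) (RatFunc.X ^ 6) k)⁻¹) ^ 3 := by
      rw [← add_zero ((RatFunc.X ^ n - 1) ^ 2 * _), ← add_zero (_ + 0)]
      nth_rewrite 1 [← v1]
      rw [← mul_zero 2, ← v2]
      simp only [Finset.mul_sum, ← Finset.sum_add_distrib]
      refine Finset.sum_congr rfl fun k _ => ?_
      rw [pow_mul, inv_pow, ← div_eq_mul_inv]
      linear_combination (RatFunc.X ^ 6) ^ k /
        qPoch ((RatFunc.X : RatFunc ℚ) ^ 6) (RatFunc.X ^ 6) k ^ 3 * hcomb k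
    rw [hg'] at hsum
    rw [map_pow]
    have : (3 : RatFunc ℚ) ≠ 0 := by norm_num
    linear_combination (3 : RatFunc ℚ)⁻¹ * hsum
  · refine O.mul_mem (O.mul_mem h3 (O.pow_mem (algebraMap_mem_coprimeDenom _ g) 2))
      (O.sum_mem fun k hk => O.mul_mem (O.mul_mem (hc k) (O.pow_mem (O.pow_mem hX 6) k))
        (O.pow_mem (inv_qPoch_mem_coprimeDenom hcop (Finset.mem_range.1 hk)) 3))
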